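/- Let ρ satisfy condition (3) with S = 0, 0 < t ≤ R, and let L^t be the image of K^t under (z,w) ↦ (z, w, I(z,w)) with Iⱼ(z,w) = (∂ρ/∂wⱼ(z,w)) / (Σₖ wₖ ∂ρ/∂wₖ(z,w)). Then for every z ∈ Γ, the fiber over z of the polynomial hull of L^t equals the fiber L^t_z; that is, (L^t)^∧_z = L^t_z. -/

import Mathlib

open Complex Metric MeasureTheory Filter Set

noncomputable section

/-- The unit circle `Γ` in `ℂ`. -/
def Circ : Set ℂ := Metric.sphere (0 : ℂ) 1

/-- The closed unit disk `Δ` in `ℂ`. -/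
def Disk : Set ℂ := Metric.closedBall (0 : ℂ) 1

/-- The Euclidean norm on `ℂⁿ`. -/
def euclNorm {n : ℕ} (w : Fin n → ℂ) : ℝ := Real.sqrt (∑ j, Complex.normSq (w j))

/-- The complex partial derivative `∂g/∂wⱼ` of a real-valued function `g` on `ℂⁿ`. -/
def wderiv {n : ℕ} (g : (Fin n → ℂ) → ℝ) (w : Fin n → ℂ) (j : Fin n) : ℂ :=
  (((fderiv ℝ g w) (Pi.single j 1) : ℝ) - Complex.I * ((fderiv ℝ g w) (Pi.single j Complex.I) : ℝ)) / 2

/-- The affine complex tangent plane at `p` to the level set of `g` through `p`. -/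
def TangentPlane {n : ℕ} (g : (Fin n → ℂ) → ℝ) (p : Fin n → ℂ) : Set (Fin n → ℂ) :=
  {w | ∑ j, (w j - p j) * wderiv g p j = 0}

/-- `ρ` is strictly hypoconvex on a subset `U` of `Γ × ℂⁿ`: on every compact subset
there is `𝒦 > 0` such that the real Hessian in `w` is `≥ 𝒦‖u‖²` on complex tangent
vectors `u` of the fibers. -/
def StrictHypoconvexOn {n : ℕ} (ρ : ℂ → (Fin n → ℂ) → ℝ) (U : Set (ℂ × (Fin n → ℂ))) : Prop :=
  ∀ C : Set (ℂ × (Fin n → ℂ)), C ⊆ U → IsCompact C →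
    ∃ K0 > (0:ℝ), ∀ p ∈ C, ∀ u : Fin n → ℂ,
      (∑ j, u j * wderiv (ρ p.1) p.2 j) = 0 →
      K0 * (euclNorm u)^2 ≤ iteratedFDeriv ℝ 2 (ρ p.1) p.2 ![u, u]

/-- Two subsets of real normed spaces are (C⁶-)diffeomorphic: there are C⁶ maps on
open neighborhoods carrying one onto the other, inverse to each other on the sets. -/
def DiffeomorphicSets {E F : Type*} [NormedAddCommGroup E] [NormedSpace ℝ E]
    [NormedAddCommGroup F] [NormedSpace ℝ F] (A : Set E) (B : Set F) : Prop :=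
  ∃ (U : Set E) (V : Set F) (f : E → F) (g : F → E),
    IsOpen U ∧ IsOpen V ∧ A ⊆ U ∧ B ⊆ V ∧
    ContDiffOn ℝ 6 f U ∧ ContDiffOn ℝ 6 g V ∧
    Set.MapsTo f A B ∧ Set.MapsTo g B A ∧
    (∀ x ∈ A, g (f x) = x) ∧ (∀ y ∈ B, f (g y) = y)

/-- Condition (3) of the paper, for `ρ` with respect to `R` and `S`. -/
structure Cond3 (n : ℕ) (ρ : ℂ → (Fin n → ℂ) → ℝ) (R : ℝ) (S : ℂ → Fin n → ℂ) : Prop where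
  hn : 2 ≤ n
  nonneg : ∀ z ∈ Circ, ∀ w, 0 ≤ ρ z w
  cont : ContinuousOn (fun p : ℂ × (Fin n → ℂ) => ρ p.1 p.2) {p | p.1 ∈ Circ}
  smooth : ContDiffOn ℝ 6 (fun p : ℂ × (Fin n → ℂ) => ρ p.1 p.2)
      {p | p.1 ∈ Circ ∧ ρ p.1 p.2 ≠ 0}
  hR : 1 < R
  grad_ne : ∀ z ∈ Circ, ∀ w, 0 < ρ z w → ρ z w ≤ R → fderiv ℝ (ρ z) w ≠ 0
  hypo : StrictHypoconvexOn ρ {p | p.1 ∈ Circ ∧ ρ p.1 p.2 ≠ 0}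
  levelCompact : ∀ t : ℝ, 0 < t → t ≤ R →
      IsCompact {p : ℂ × (Fin n → ℂ) | p.1 ∈ Circ ∧ ρ p.1 p.2 = t}
  fiberSphere : ∀ t : ℝ, 0 < t → t ≤ R → ∀ z ∈ Circ,
      DiffeomorphicSets {w | ρ z w = t} (Metric.sphere (0 : EuclideanSpace ℂ (Fin n)) 1)
  levelR : ∀ z ∈ Circ, ∀ w, ρ z w = R ↔ euclNorm w = R
  aboveR : ∀ z ∈ Circ, ∀ w, R < euclNorm w → R < ρ z w
  Scont : ContinuousOn S Circ
  Ssmall : ∀ z ∈ Circ, euclNorm (S z) < R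
  Szero : ∀ z ∈ Circ, ∀ w, ρ z w = 0 ↔ w = S z

/-- The `j`-th Fourier coefficient of the boundary values of `f` on the circle. -/
def bCoeff (f : ℂ → ℂ) (j : ℤ) : ℂ :=
  (1 / (2 * Real.pi) : ℂ) * ∫ θ in (0:ℝ)..(2 * Real.pi),
    f (Complex.exp (↑θ * Complex.I)) * Complex.exp (-(j : ℂ) * ↑θ * Complex.I)

/-- The Hilbert space `ℓ²(ℤ)` used to represent `W^{1,2}(Γ)`. -/
abbrev Seq2 : Type := lp (fun _ : ℤ => ℂ) 2

/-- `a ∈ ℓ²(ℤ)` is the (weighted) Fourier coefficient representation of `f` in the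
Sobolev space `W^{1,2}(Γ)`; the weight `√(1+j²)` makes the `ℓ²` norm of `a`
equivalent to the `W^{1,2}` norm of `f`. -/
def RepOf (a : Seq2) (f : ℂ → ℂ) : Prop :=
  ∀ j : ℤ, (a : ∀ _ : ℤ, ℂ) j = (Real.sqrt (1 + (j:ℝ)^2) : ℂ) * bCoeff f j

/-- Membership in `H^{1,2}(Δ) = H²(Δ) ∩ W^{1,2}(Γ)` (whose elements extend
continuously to the closed disk). -/
def MemH12 (f : ℂ → ℂ) : Prop :=
  ContinuousOn f Disk ∧ DifferentiableOn ℂ f (Metric.ball (0:ℂ) 1) ∧ ∃ a : Seq2, RepOf a f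

/-- Membership in the disk algebra `A(Δ)`. -/
def MemA (f : ℂ → ℂ) : Prop :=
  ContinuousOn f Disk ∧ DifferentiableOn ℂ f (Metric.ball (0:ℂ) 1)

/-- Membership in `H^∞(Δ)`. -/
def MemHinf (f : ℂ → ℂ) : Prop :=
  DifferentiableOn ℂ f (Metric.ball (0:ℂ) 1) ∧ ∃ M : ℝ, ∀ z ∈ Metric.ball (0:ℂ) 1, ‖f z‖ ≤ M

/-- `f` is `C^k`-smooth on the circle `Γ`. -/
def CkCirc (k : ℕ) (f : ℂ → ℂ) : Prop :=
  ContDiff ℝ k (fun θ : ℝ => f (Complex.exp (↑θ * Complex.I)))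

/-- `f` is `C⁴`-smooth on the circle `Γ`. -/
def C4Circ (f : ℂ → ℂ) : Prop := CkCirc 4 f

/-- Vector-valued versions. -/
def MemH12V {n : ℕ} (f : ℂ → Fin n → ℂ) : Prop := ∀ j, MemH12 fun z => f z j
def MemAV {n : ℕ} (f : ℂ → Fin n → ℂ) : Prop := ∀ j, MemA fun z => f z j
def MemHinfV {n : ℕ} (f : ℂ → Fin n → ℂ) : Prop := ∀ j, MemHinf fun z => f z j
def C4CircV {n : ℕ} (f : ℂ → Fin n → ℂ) : Prop := ∀ j, C4Circ fun z => f z j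

/-- The coordinates of a point of `ℂ × ℂⁿ` as a point of `ℂ^{n+1}`. -/
def pcoords {n : ℕ} (p : ℂ × (Fin n → ℂ)) : Fin (n+1) → ℂ := Fin.cons p.1 p.2

/-- The polynomial hull of a subset of `ℂ × ℂⁿ ≅ ℂ^{n+1}`. -/
def polyHull {n : ℕ} (Y : Set (ℂ × (Fin n → ℂ))) : Set (ℂ × (Fin n → ℂ)) :=
  {p | ∀ P : MvPolynomial (Fin (n+1)) ℂ, ∀ M : ℝ,
    (∀ q ∈ Y, ‖MvPolynomial.eval (pcoords q) P‖ ≤ M) → ‖MvPolynomial.eval (pcoords p) P‖ ≤ M}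

/-- The polynomial hull of a subset of `ℂⁿ`. -/
def polyHulln {n : ℕ} (Y : Set (Fin n → ℂ)) : Set (Fin n → ℂ) :=
  {w | ∀ P : MvPolynomial (Fin n) ℂ, ∀ M : ℝ,
    (∀ v ∈ Y, ‖MvPolynomial.eval v P‖ ≤ M) → ‖MvPolynomial.eval w P‖ ≤ M}

/-- The coordinates of a point of `ℂ × ℂⁿ × ℂⁿ` as a point of `ℂ^{2n+1}`. -/
def pcoords2 {n : ℕ} (p : ℂ × ((Fin n → ℂ) × (Fin n → ℂ))) : Fin (n + n + 1) → ℂ :=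
  Fin.cons p.1 (Fin.append p.2.1 p.2.2)

/-- The polynomial hull of a subset of `ℂ × ℂⁿ × ℂⁿ ≅ ℂ^{2n+1}`. -/
def polyHull2 {n : ℕ} (Y : Set (ℂ × ((Fin n → ℂ) × (Fin n → ℂ)))) :
    Set (ℂ × ((Fin n → ℂ) × (Fin n → ℂ))) :=
  {p | ∀ P : MvPolynomial (Fin (n + n + 1)) ℂ, ∀ M : ℝ,
    (∀ q ∈ Y, ‖MvPolynomial.eval (pcoords2 q) P‖ ≤ M) → ‖MvPolynomial.eval (pcoords2 p) P‖ ≤ M}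

/-- A subset of `ℂⁿ` is hypoconvex if its complement is a union of complex affine
hyperplanes. -/
def HypoconvexSet {n : ℕ} (A : Set (Fin n → ℂ)) : Prop :=
  ∀ v : Fin n → ℂ, v ∉ A → ∃ (c : Fin n → ℂ) (d : ℂ), c ≠ 0 ∧
    (∑ j, c j * v j) = d ∧ ∀ w ∈ A, (∑ j, c j * w j) ≠ d

/-- `A` has `C^k` boundary: near each boundary point the boundary is the zero set of a
`C^k` function with nonvanishing gradient. -/
def CkBoundary {E : Type*} [NormedAddCommGroup E] [NormedSpace ℝ E] (k : ℕ) (A : Set E) : Prop :=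
  ∀ p ∈ frontier A, ∃ U : Set E, IsOpen U ∧ p ∈ U ∧
    ∃ φ : E → ℝ, ContDiffOn ℝ k φ U ∧ (∀ x ∈ U, fderiv ℝ φ x ≠ 0) ∧
      frontier A ∩ U = {x | φ x = 0} ∩ U

/-- `fb` gives the a.e. radial boundary values on `Γ` of the function `f` on the open disk. -/
def IsBdryVal {n : ℕ} (f fb : ℂ → Fin n → ℂ) : Prop :=
  ∀ᵐ (θ : ℝ) ∂(volume.restrict (Set.Ioc (0:ℝ) (2 * Real.pi))),
    Filter.Tendsto (fun r : ℝ => f ((r : ℂ) * Complex.exp (↑θ * Complex.I)))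
      (nhdsWithin 1 (Set.Iio 1)) (nhds (fb (Complex.exp (↑θ * Complex.I))))

/-- The optimal control `γ_ρ = inf_{f ∈ H^∞(Δ)ⁿ} ess sup_{z ∈ Γ} ρ(z,f(z))`. -/
def gammaRho {n : ℕ} (ρ : ℂ → (Fin n → ℂ) → ℝ) : ℝ :=
  sInf {c : ℝ | ∃ f fb : ℂ → Fin n → ℂ, MemHinfV f ∧ IsBdryVal f fb ∧
    ∀ᵐ (θ : ℝ) ∂(volume.restrict (Set.Ioc (0:ℝ) (2 * Real.pi))),
      ρ (Complex.exp (↑θ * Complex.I)) (fb (Complex.exp (↑θ * Complex.I))) ≤ c}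

/-- `δ_ρ = inf_{f ∈ A(Δ)ⁿ} sup_{z ∈ Γ} ρ(z,f(z))`. -/
def deltaRho {n : ℕ} (ρ : ℂ → (Fin n → ℂ) → ℝ) : ℝ :=
  sInf {c : ℝ | ∃ f : ℂ → Fin n → ℂ, MemAV f ∧ ∀ z ∈ Circ, ρ z (f z) ≤ c}

/-- `ρ_m(z,w) = ρ(z, w/zᵐ)`. -/
def rhoShift {n : ℕ} (ρ : ℂ → (Fin n → ℂ) → ℝ) (m : ℕ) : ℂ → (Fin n → ℂ) → ℝ :=
  fun z w => ρ z (fun j => w j / z ^ m)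

/-- `q` is an `n`-tuple of harmonic polynomials. -/
def HarmPolyTuple {n : ℕ} (q : ℂ → Fin n → ℂ) : Prop :=
  ∃ (d : ℕ) (a b : ℕ → Fin n → ℂ), ∀ z : ℂ, ∀ j,
    q z j = ∑ i ∈ Finset.range (d+1), (a i j * z ^ i + b i j * (starRingEnd ℂ z) ^ i)

/-- `zᵐ q(z)` has analytic polynomial coordinates (as boundary values on `Γ`). -/
def ZmAnalytic {n : ℕ} (m : ℕ) (q : ℂ → Fin n → ℂ) : Prop :=
  ∀ j, ∃ p : Polynomial ℂ, ∀ z ∈ Circ, z ^ m * q z j = Polynomial.eval z p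

/-- The boundary function `q` on `Γ` is analytic, i.e. agrees on `Γ` with an element
of `A(Δ)ⁿ`. -/
def BoundaryAnalytic {n : ℕ} (q : ℂ → Fin n → ℂ) : Prop :=
  ∃ h : ℂ → Fin n → ℂ, MemAV h ∧ ∀ z ∈ Circ, h z = q z


def RegPt {E : Type*} [TopologicalSpace E] (h : E → ℝ) (x : E) : Prop :=
  ∃ N ∈ nhds x, ∃ G : Set E, IsPreconnected G ∧ (∀ y ∈ G, h y < h x) ∧
    (∀ y ∈ N, h y < h x → y ∈ G) ∧ (∀ y ∈ N, h y ≤ h x → y ∈ closure G)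

def IsoPt {E : Type*} [TopologicalSpace E] (h : E → ℝ) (x : E) : Prop :=
  ∀ᶠ y in nhds x, y ≠ x → h x < h y

lemma segment_anti {E : Type*} [NormedAddCommGroup E] [NormedSpace ℝ E] (h : E → ℝ)
    (y v : E)
    (hd : ∀ s ∈ Icc (0:ℝ) 1, DifferentiableAt ℝ h (y + s • v))
    (hn : ∀ s ∈ Ioo (0:ℝ) 1, fderiv ℝ h (y + s • v) v < 0) :
    StrictAntiOn (fun s : ℝ => h (y + s • v)) (Icc 0 1) := by
  have hder : ∀ s ∈ Icc (0:ℝ) 1,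
      HasDerivAt (fun s : ℝ => h (y + s • v)) (fderiv ℝ h (y + s • v) v) s := by
    intro s hs
    have h1 : HasDerivAt (fun s : ℝ => y + s • v) v s := by
      simpa using ((hasDerivAt_id s).smul_const v).const_add y
    exact (hd s hs).hasFDerivAt.comp_hasDerivAt s h1
  apply strictAntiOn_of_deriv_neg (convex_Icc 0 1)
  · intro s hs
    exact (hder s hs).continuousAt.continuousWithinAt
  · intro s hs
    rw [interior_Icc] at hs
    rw [(hder s (Ioo_subset_Icc_self hs)).deriv]
    exact hn s hs

lemma regPt_of_fderiv {E : Type*} [NormedAddCommGroup E] [NormedSpace ℝ E] (h : E → ℝ)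
    (x : E) (hc : ContDiffAt ℝ 1 h x) (hne : fderiv ℝ h x ≠ 0) : RegPt h x := by
  obtain ⟨v0, hv0⟩ : ∃ v, fderiv ℝ h x v < 0 := by
    by_contra! hcon
    apply hne
    ext v
    have h1 := hcon v
    have h2 := hcon (-v)
    simp only [map_neg] at h2
    simp only [_root_.zero_apply]
    linarith
  have hcf : ContinuousAt (fderiv ℝ h) x := (hc.fderiv_right (m := 0) le_rfl).continuousAt
  have hcv : ContinuousAt (fun y => fderiv ℝ h y v0) x := hcf.clm_apply continuousAt_const
  have ev1 : ∀ᶠ y in nhds x, fderiv ℝ h y v0 < 0 := hcv.eventually_lt continuousAt_const hv0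
  have ev2 : ∀ᶠ y in nhds x, DifferentiableAt ℝ h y := by
    filter_upwards [hc.eventually (by simp)] with y hy
    exact hy.differentiableAt (by simp)
  obtain ⟨r0, hr0, hball⟩ := Metric.eventually_nhds_iff_ball.1 (ev1.and ev2)
  -- rescale
  obtain ⟨τ, hτ, hτv⟩ : ∃ τ : ℝ, 0 < τ ∧ ‖τ • v0‖ < r0 / 2 := by
    refine ⟨r0 / 2 / (‖v0‖ + 1), by positivity, ?_⟩
    rw [norm_smul, Real.norm_of_nonneg (by positivity), div_mul_eq_mul_div, div_lt_iff₀ (by positivity)]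
    nlinarith [norm_nonneg v0]
  set v := τ • v0 with hv
  have hin : ∀ y ∈ ball x (r0/2), ∀ s ∈ Icc (0:ℝ) 1, y + s • v ∈ ball x r0 := by
    intro y hy s hs
    rw [mem_ball, dist_eq_norm] at hy ⊢
    have : ‖s • v‖ ≤ ‖v‖ := by
      rw [norm_smul, Real.norm_of_nonneg hs.1]
      nlinarith [norm_nonneg v, hs.2]
    calc ‖y + s • v - x‖ = ‖(y - x) + s • v‖ := by congr 1; abel
      _ ≤ ‖y - x‖ + ‖s • v‖ := norm_add_le _ _
      _ < r0 := by linarith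
  have hanti : ∀ y ∈ ball x (r0/2), StrictAntiOn (fun s : ℝ => h (y + s • v)) (Icc 0 1) := by
    intro y hy
    apply segment_anti
    · intro s hs
      exact (hball _ (hin y hy s hs)).2
    · intro s hs
      have := (hball _ (hin y hy s (Ioo_subset_Icc_self hs))).1
      rw [hv, map_smul, smul_eq_mul]
      exact mul_neg_of_pos_of_neg hτ this
  have hxb : x ∈ ball x (r0/2) := mem_ball_self (by positivity)
  have hxv : h (x + v) < h x := by
    have := hanti x hxb (a := 0) (b := 1) (by simp) (by simp) one_pos
    simpa using this
  have hcxv : ContinuousAt h (x + v) := by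
    have : x + v ∈ ball x r0 := by simpa using hin x hxb 1 (by simp)
    exact (hball _ this).2.continuousAt
  obtain ⟨r1, hr1, hball1⟩ := Metric.eventually_nhds_iff_ball.1
    (hcxv.eventually_lt continuousAt_const hxv)
  set r := min r1 (r0/2) with hr
  have hrpos : 0 < r := lt_min hr1 (by positivity)
  have hsub : ball x r ⊆ ball x (r0/2) := ball_subset_ball (min_le_right _ _)
  have hend : ∀ y ∈ ball x r, y + v ∈ ball (x + v) r := by
    intro y hy
    simpa [mem_ball, dist_eq_norm] using hy
  have hlow : ∀ y ∈ ball (x + v) r, h y < h x := fun y hy =>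
    hball1 y (ball_subset_ball (min_le_left _ _) hy)
  refine ⟨ball x r, ball_mem_nhds x hrpos,
    {y' | ∃ y ∈ ball x r, ∃ s ∈ Icc (0:ℝ) 1, y' = y + s • v ∧ h y' < h x}, ?_, ?_, ?_, ?_⟩
  · apply isPreconnected_of_forall (x + v)
    rintro y' ⟨y, hy, s, hs, rfl, hlt⟩
    refine ⟨ball (x+v) r ∪ (fun s : ℝ => y + s • v) '' Icc s 1, ?_, ?_, ?_, ?_⟩
    · rintro w (hw | ⟨s', hs', rfl⟩)
      · refine ⟨w - v, ?_, 1, by simp, by simp, hlow w hw⟩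
        rw [mem_ball, dist_eq_norm] at hw ⊢
        rwa [show w - v - x = w - (x + v) by abel]
      · refine ⟨y, hy, s', ⟨hs.1.trans hs'.1, hs'.2⟩, rfl, ?_⟩
        refine lt_of_le_of_lt ?_ hlt
        exact (hanti y (hsub hy)).antitoneOn hs ⟨hs.1.trans hs'.1, hs'.2⟩ hs'.1
    · left; exact mem_ball_self hrpos
    · right; exact ⟨s, ⟨le_rfl, hs.2⟩, rfl⟩
    · refine IsPreconnected.union (y + v) (hend y hy) ⟨1, ⟨hs.2, le_rfl⟩, by simp⟩
        (convex_ball _ _).isPreconnected ?_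
      apply isPreconnected_Icc.image
      fun_prop
  · rintro y ⟨_, _, _, _, _, hlt⟩
    exact hlt
  · intro y hy hlt
    exact ⟨y, hy, 0, by simp, by simp, hlt⟩
  · intro y hy hle
    have ht : Tendsto (fun s : ℝ => y + s • v) (nhdsWithin 0 (Ioi 0)) (nhds y) := by
      have : Continuous (fun s : ℝ => y + s • v) := by fun_prop
      have h2 := this.tendsto 0
      simp only [zero_smul, add_zero] at h2
      exact h2.mono_left nhdsWithin_le_nhds
    refine mem_closure_of_tendsto ht ?_
    filter_upwards [Ioc_mem_nhdsGT (zero_lt_one' ℝ)] with s hs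
    refine ⟨y, hy, s, ⟨hs.1.le, hs.2⟩, rfl, ?_⟩
    have := hanti y (hsub hy) (a := 0) (b := s) (by simp) ⟨hs.1.le, hs.2⟩ hs.1
    simp only [zero_smul, add_zero] at this
    linarith

lemma strict_min_of_hess {E : Type*} [NormedAddCommGroup E] [NormedSpace ℝ E] (g : E → ℝ)
    (q : E) (hc : ContDiffAt ℝ 2 g q) (V : Set E) (k : ℝ) (hk : 0 < k)
    (hV : ∀ u ∈ V, fderiv ℝ g q u = 0 ∧ k * ‖u‖^2 ≤ fderiv ℝ (fderiv ℝ g) q u u) :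
    ∃ r > 0, ∀ u ∈ V, u ≠ 0 → ‖u‖ < r → g q < g (q + u) := by
  have hdd : HasFDerivAt (fderiv ℝ g) (fderiv ℝ (fderiv ℝ g) q) q :=
    ((hc.fderiv_right (m := 1) (by norm_num)).differentiableAt (by simp)).hasFDerivAt
  have ev1 := (hasFDerivAt_iff_isLittleO_nhds_zero.1 hdd).bound (half_pos hk)
  have ev2 : ∀ᶠ y in nhds q, DifferentiableAt ℝ g y := by
    filter_upwards [hc.eventually (by simp)] with y hy
    exact hy.differentiableAt (by simp)
  obtain ⟨r1, hr1, hb1⟩ := Metric.eventually_nhds_iff_ball.1 ev1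
  obtain ⟨r2, hr2, hb2⟩ := Metric.eventually_nhds_iff_ball.1 ev2
  refine ⟨min r1 r2, lt_min hr1 hr2, ?_⟩
  intro u hu hu0 hur
  have hsu : ∀ s ∈ Icc (0:ℝ) 1, ‖s • u‖ < min r1 r2 := by
    intro s hs
    refine lt_of_le_of_lt ?_ hur
    rw [norm_smul, Real.norm_of_nonneg hs.1]
    nlinarith [norm_nonneg u, hs.2]
  have := segment_anti (fun y => - g y) q u ?_ ?_
  · have h3 := this (a := 0) (b := 1) (by simp) (by simp) one_pos
    simp only [one_smul, zero_smul, add_zero] at h3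
    linarith
  · intro s hs
    refine (hb2 _ ?_).fun_neg
    simpa [mem_ball, dist_eq_norm] using (hsu s hs).trans_le (min_le_right _ _)
  · intro s hs
    have h1 := hb1 (s • u) (by
      simpa [mem_ball, dist_eq_norm] using (hsu s (Ioo_subset_Icc_self hs)).trans_le (min_le_left _ _))
    have h2 := ContinuousLinearMap.le_opNorm
      (fderiv ℝ g (q + s • u) - fderiv ℝ g q - (fderiv ℝ (fderiv ℝ g) q) (s • u)) u
    obtain ⟨hz, hp⟩ := hV u hu
    have h4 : fderiv ℝ (fun y => - g y) (q + s • u) = - fderiv ℝ g (q + s • u) := fderiv_fun_neg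
    rw [h4]
    simp only [_root_.sub_apply, map_smul, _root_.smul_apply, hz,
      _root_.neg_apply, smul_eq_mul, sub_zero] at h2 h1 ⊢
    rw [norm_smul, Real.norm_of_nonneg hs.1.le] at h1
    have h5 := abs_le.1 (h2.trans (mul_le_mul_of_nonneg_right h1 (norm_nonneg u)))
    have hupos : 0 < ‖u‖ := norm_pos_iff.2 hu0
    have h6 : 0 < s * (k / 2 * ‖u‖^2) := by have := hs.1; positivity
    have h7 : s * (k * ‖u‖^2) ≤ s * (fderiv ℝ (fderiv ℝ g) q u u) :=
      mul_le_mul_of_nonneg_left hp hs.1.le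
    nlinarith [h5.1]

lemma mp_gap {E : Type*} [TopologicalSpace E] [LocallyCompactSpace E] [T2Space E]
    (h : E → ℝ) (hcont : Continuous h) (c : ℝ) (A : Set E) (hA : IsCompact A)
    (a b : E) (ha : a ∈ A) (hb : b ∉ A)
    (hloc : ∀ x ∈ A, ∀ᶠ y in nhds x, h y ≤ c → y ∈ A) :
    ∃ ε > 0, ∀ J : Set E, IsPreconnected J → a ∈ J → b ∈ J → ∃ y ∈ J, c + ε ≤ h y := by
  set W := interior {y | h y ≤ c → y ∈ A} \ {b} with hW
  have hWo : IsOpen W := isOpen_interior.sdiff isClosed_singleton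
  have hAW : A ⊆ W := fun x hx => ⟨mem_interior_iff_mem_nhds.2 (hloc x hx), fun h' => hb (h' ▸ hx)⟩
  obtain ⟨V, hVo, hAV, hVW, hVc⟩ := exists_open_between_and_isCompact_closure hA hWo hAW
  have hF : IsCompact (frontier V) := hVc.of_isClosed_subset isClosed_frontier frontier_subset_closure
  have hFc : ∀ x ∈ frontier V, c < h x := by
    intro x hx
    by_contra! hle
    have hxW := hVW (frontier_subset_closure hx)
    have hxA : x ∈ A := interior_subset hxW.1 hle
    rw [hVo.frontier_eq] at hx
    exact hx.2 (hAV hxA)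
  have hmeet : ∀ J : Set E, IsPreconnected J → a ∈ J → b ∈ J → ∃ y ∈ J, y ∈ frontier V := by
    intro J hJ haJ hbJ
    by_contra! hcon
    have hbV : b ∉ V := fun hbV => (hVW (subset_closure hbV)).2 rfl
    have := hJ.subset_of_closure_inter_subset hVo ⟨a, haJ, hAV ha⟩ (by
      rintro y ⟨hy1, hy2⟩
      by_contra hyV
      exact hcon y hy2 (by rw [hVo.frontier_eq]; exact ⟨hy1, hyV⟩))
    exact hbV (this hbJ)
  rcases (frontier V).eq_empty_or_nonempty with he | hne
  · refine ⟨1, one_pos, ?_⟩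
    intro J hJ haJ hbJ
    obtain ⟨y, _, hy⟩ := hmeet J hJ haJ hbJ
    simp [he] at hy
  · obtain ⟨x0, hx0, hmin⟩ := hF.exists_isMinOn hne hcont.continuousOn
    refine ⟨h x0 - c, sub_pos.2 (hFc x0 hx0), ?_⟩
    intro J hJ haJ hbJ
    obtain ⟨y, hy1, hy2⟩ := hmeet J hJ haJ hbJ
    exact ⟨y, hy1, by have := hmin hy2; simp only [mem_ofPred_eq] at this; linarith⟩

lemma mountain_pass {E : Type*} [NormedAddCommGroup E] [NormedSpace ℝ E] [ProperSpace E]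
    (h : E → ℝ) (hcont : Continuous h) (R : ℝ)
    (hcomp : IsCompact {x | h x ≤ R}) (hconn : IsPreconnected {x | h x ≤ R})
    (hpt : ∀ x, h x ≤ R → IsoPt h x ∨ RegPt h x)
    (a b : E) (hab : a ≠ b) (hba : h b ≤ h a) (haR : h a ≤ R) (ha : IsoPt h a) : False := by
  set S : Set ℝ := {c | ∃ J : Set E, IsPreconnected J ∧ a ∈ J ∧ b ∈ J ∧ ∀ y ∈ J, h y ≤ c} with hS
  have hRS : R ∈ S := ⟨_, hconn, haR, hba.trans haR, fun y hy => hy⟩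
  have hbdd : BddBelow S := ⟨h a, by rintro c ⟨J, _, haJ, _, hJ⟩; exact hJ a haJ⟩
  set c := sInf S with hc
  have hcR : c ≤ R := csInf_le hbdd hRS
  have hac : h a ≤ c := le_csInf ⟨R, hRS⟩ (by rintro c ⟨J, _, haJ, _, hJ⟩; exact hJ a haJ)
  -- it is enough to find a set as in mp_gap
  have key : ∀ A : Set E, IsCompact A → a ∈ A → b ∉ A →
      (∀ x ∈ A, ∀ᶠ y in nhds x, h y ≤ c → y ∈ A) → False := by
    intro A hA haA hbA hloc
    obtain ⟨ε, hε, hJ⟩ := mp_gap h hcont c A hA a b haA hbA hloc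
    obtain ⟨s, hsS, hs⟩ := exists_lt_of_csInf_lt ⟨R, hRS⟩ (show sInf S < c + ε by linarith)
    obtain ⟨J, hJ1, hJ2, hJ3, hJ4⟩ := hsS
    obtain ⟨y, hy1, hy2⟩ := hJ J hJ1 hJ2 hJ3
    have := hJ4 y hy1
    linarith
  rcases hac.eq_or_lt with hac | hac
  · refine key {a} isCompact_singleton rfl (fun h' => hab h'.symm) ?_
    rintro x rfl
    filter_upwards [ha] with y hy hle
    by_contra hne
    have := hy hne
    linarith
  · set U : Set E := {x | h x < c} with hU
    have hUo : IsOpen U := isOpen_lt hcont continuous_const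
    set C := connectedComponentIn U a with hC
    have hCo : IsOpen C := hUo.connectedComponentIn
    have hCp : IsPreconnected C := isPreconnected_connectedComponentIn
    have hCU : C ⊆ U := connectedComponentIn_subset U a
    have haC : a ∈ C := mem_connectedComponentIn hac
    have hclo : ∀ x ∈ closure C, h x < c → x ∈ C := by
      intro x hx hxc
      have h1 : IsPreconnected (insert x C) :=
        hCp.subset_closure (subset_insert _ _) (insert_subset hx subset_closure)
      exact h1.subset_connectedComponentIn (mem_insert_of_mem _ haC)
        (insert_subset hxc hCU) (mem_insert _ _)
    have hcle : ∀ x ∈ closure C, h x ≤ c := by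
      intro x hx
      have : closure C ⊆ {x | h x ≤ c} :=
        closure_minimal (fun y hy => by have h9 : h y < c := hCU hy; exact h9.le) (isClosed_le hcont continuous_const)
      exact this hx
    by_cases hbC : b ∈ C
    · have hpc : IsPathConnected C := hCo.isConnected_iff_isPathConnected.1 ⟨⟨a, haC⟩, hCp⟩
      obtain ⟨γ, hγ⟩ := hpc.joinedIn a haC b hbC
      obtain ⟨s0, -, hs0⟩ := (isCompact_univ (X := unitInterval)).exists_isMaxOn ⟨0, trivial⟩
        (f := fun s => h (γ s)) (hcont.comp γ.continuous).continuousOn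
      have hmem : h (γ s0) ∈ S := by
        refine ⟨range γ, isPreconnected_range γ.continuous, ⟨0, γ.source⟩, ⟨1, γ.target⟩, ?_⟩
        rintro _ ⟨s, rfl⟩
        exact hs0 (mem_univ s)
      have h1 := csInf_le hbdd hmem
      have h2 : h (γ s0) < c := hCU (hγ s0)
      linarith
    · refine key (closure C) ?_ (subset_closure haC) ?_ ?_
      · exact hcomp.of_isClosed_subset isClosed_closure (fun x hx => (hcle x hx).trans hcR)
      · exact fun hb' => hbC (hclo b hb' (hba.trans_lt hac))
      · intro x hx
        rcases (hcle x hx).eq_or_lt with hxc | hxc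
        · rcases hpt x (hxc.le.trans hcR) with hi | ⟨N, hN, G, hG, hG1, hG2, hG3⟩
          · exfalso
            obtain ⟨y, hy1, hy2⟩ := mem_closure_iff_nhds.1 hx _ hi
            have h3 : h y < c := hCU hy2
            have h4 : h x < h y := hy1 (by rintro rfl; linarith)
            linarith
          · obtain ⟨y, hy1, hy2⟩ := mem_closure_iff_nhds.1 hx _ hN
            have h3 : h y < c := hCU hy2
            have hyG : y ∈ G := hG2 y hy1 (by rw [hxc]; exact h3)
            have hGC : G ⊆ C := by
              have h4 := hG.subset_connectedComponentIn (F := U) hyG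
                (fun w hw => by have := hG1 w hw; rw [hxc] at this; exact this)
              rw [← connectedComponentIn_eq hy2] at h4
              exact h4
            filter_upwards [hN] with w hw hwc
            exact closure_mono hGC (hG3 w hw (by rw [hxc]; exact hwc))
        · filter_upwards [hCo.mem_nhds (hclo x hx hxc)] with y hy _
          exact subset_closure hy

structure FiberOK {n : ℕ} (g : (Fin n → ℂ) → ℝ) (R : ℝ) : Prop where
  cont : Continuous g
  smooth : ∀ w, g w ≠ 0 → ContDiffAt ℝ 2 g w
  nonneg : ∀ w, 0 ≤ g w
  hR : 0 < R
  grad : ∀ w, 0 < g w → g w ≤ R → fderiv ℝ g w ≠ 0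
  hypo : ∀ w, g w ≠ 0 → ∃ k > 0, ∀ u : Fin n → ℂ, ∑ j, u j * wderiv g w j = 0 →
    k * ‖u‖ ^ 2 ≤ fderiv ℝ (fderiv ℝ g) w u u
  levelR : ∀ w, g w = R ↔ euclNorm w = R
  aboveR : ∀ w, R < euclNorm w → R < g w
  zero : ∀ w, g w = 0 ↔ w = 0

lemma fderiv_decomp {n : ℕ} (T : (Fin n → ℂ) →L[ℝ] ℝ) (u : Fin n → ℂ) :
    T u = ∑ j, ((u j).re * T (Pi.single j 1) + (u j).im * T (Pi.single j Complex.I)) := by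
  have h1 : u = ∑ j, ((u j).re • (Pi.single j 1 : Fin n → ℂ)
      + (u j).im • (Pi.single j Complex.I : Fin n → ℂ)) := by
    ext i
    simp only [Finset.sum_apply, Pi.add_apply, Pi.smul_apply, Pi.single_apply]
    rw [Finset.sum_eq_single i]
    · simp [Complex.re_add_im]
    · intro b _ hb
      simp [hb.symm]
    · simp
  conv_lhs => rw [h1]
  simp [map_sum, map_add, map_smul]

lemma wderiv_sum {n : ℕ} (g : (Fin n → ℂ) → ℝ) (w u : Fin n → ℂ) :
    ∑ j, u j * wderiv g w j =
      (((fderiv ℝ g w u : ℝ) : ℂ) - Complex.I * ((fderiv ℝ g w (Complex.I • u) : ℝ) : ℂ)) / 2 := by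
  rw [fderiv_decomp (fderiv ℝ g w) u, fderiv_decomp (fderiv ℝ g w) (Complex.I • u)]
  push_cast
  rw [Finset.mul_sum, ← Finset.sum_sub_distrib, Finset.sum_div]
  apply Finset.sum_congr rfl
  intro j _
  simp only [wderiv, Pi.smul_apply, smul_eq_mul, Complex.mul_re, Complex.mul_im, Complex.I_re,
    Complex.I_im, zero_mul, one_mul, zero_sub, zero_add]
  conv_lhs => rw [← Complex.re_add_im (u j)]
  push_cast
  linear_combination ((-1/2:ℂ) * ((u j).im : ℂ) * (fderiv ℝ g w (Pi.single j Complex.I) : ℂ)) * (Complex.I_sq)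

lemma wderiv_sum_eq_zero_iff {n : ℕ} (g : (Fin n → ℂ) → ℝ) (w u : Fin n → ℂ) :
    ∑ j, u j * wderiv g w j = 0 ↔ fderiv ℝ g w u = 0 ∧ fderiv ℝ g w (Complex.I • u) = 0 := by
  rw [wderiv_sum]
  constructor
  · intro h
    have h1 := congrArg Complex.re h
    have h2 := congrArg Complex.im h
    simp at h1 h2
    exact ⟨h1, h2⟩
  · rintro ⟨h1, h2⟩
    simp [h1, h2]

lemma euclNorm_eq {n : ℕ} (w : Fin n → ℂ) : euclNorm w = ‖(WithLp.toLp 2 w : EuclideanSpace ℂ (Fin n))‖ := by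
  rw [EuclideanSpace.norm_eq, euclNorm]
  simp [Complex.normSq_eq_norm_sq]

lemma norm_le_euclNorm {n : ℕ} (w : Fin n → ℂ) : ‖w‖ ≤ euclNorm w := by
  rw [euclNorm_eq, pi_norm_le_iff_of_nonneg (norm_nonneg _)]
  intro i
  exact PiLp.norm_apply_le (WithLp.toLp 2 w : EuclideanSpace ℂ (Fin n)) i

lemma euclNorm_convex {n : ℕ} (R : ℝ) : Convex ℝ {w : Fin n → ℂ | euclNorm w ≤ R} := by
  intro x hx y hy a b ha hb hab
  change euclNorm _ ≤ R
  change euclNorm x ≤ R at hx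
  change euclNorm y ≤ R at hy
  rw [euclNorm_eq] at *
  rw [WithLp.toLp_add, WithLp.toLp_smul, WithLp.toLp_smul]
  refine (norm_add_le _ _).trans ?_
  rw [norm_smul, norm_smul, Real.norm_of_nonneg ha, Real.norm_of_nonneg hb]
  have h1 := mul_le_mul_of_nonneg_left hx ha
  have h2 := mul_le_mul_of_nonneg_left hy hb
  have h3 : a * R + b * R = R := by rw [← add_mul, hab, one_mul]
  linarith

lemma euclNorm_smul {n : ℕ} (s : ℝ) (hs : 0 ≤ s) (w : Fin n → ℂ) :
    euclNorm (s • w) = s * euclNorm w := by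
  rw [euclNorm_eq, euclNorm_eq, WithLp.toLp_smul, norm_smul, Real.norm_of_nonneg hs]

namespace FiberOK

variable {n : ℕ} {g : (Fin n → ℂ) → ℝ} {R : ℝ}

lemma lt_iff (H : FiberOK g R) (w : Fin n → ℂ) : g w < R ↔ euclNorm w < R := by
  constructor
  · intro h
    by_contra! h1
    rcases h1.eq_or_lt with h2 | h2
    · have := (H.levelR w).2 h2.symm
      linarith
    · have := H.aboveR w h2
      linarith
  · intro h
    by_contra! h1
    have hc : ContinuousOn (fun s : ℝ => g (s • w)) (Icc 0 1) :=
      (H.cont.comp (by fun_prop)).continuousOn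
    have h0 : g 0 = 0 := (H.zero 0).2 rfl
    obtain ⟨s, hs, hs2⟩ := intermediate_value_Icc zero_le_one hc
      (show R ∈ Icc (g ((0:ℝ) • w)) (g ((1:ℝ) • w)) by simp [h0, H.hR.le, h1])
    have h2 := (H.levelR _).1 hs2
    rw [euclNorm_smul s hs.1] at h2
    have h3 : 0 ≤ euclNorm w := Real.sqrt_nonneg _
    nlinarith [hs.1, hs.2]

lemma le_iff (H : FiberOK g R) (w : Fin n → ℂ) : g w ≤ R ↔ euclNorm w ≤ R := by
  rw [le_iff_lt_or_eq, le_iff_lt_or_eq, H.lt_iff, H.levelR]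

lemma isoPt (H : FiberOK g R) (p u : Fin n → ℂ) (hu : u ≠ 0) (x : ℂ)
    (hx : g (p + x • u) ≠ 0) (hc : ∑ j, u j * wderiv g (p + x • u) j = 0) :
    IsoPt (fun ζ : ℂ => g (p + ζ • u)) x := by
  obtain ⟨k, hk, hyp⟩ := H.hypo _ hx
  have hzero : ∀ ζ : ℂ, ∑ j, (ζ • u) j * wderiv g (p + x • u) j = 0 := by
    intro ζ
    have : ∑ j, (ζ • u) j * wderiv g (p + x • u) j = ζ * ∑ j, u j * wderiv g (p + x • u) j := by
      rw [Finset.mul_sum]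
      apply Finset.sum_congr rfl
      intro j _
      simp [mul_assoc]
    rw [this, hc, mul_zero]
  obtain ⟨r, hr, hmin⟩ := strict_min_of_hess g (p + x • u) (H.smooth _ hx)
    (range (fun ζ : ℂ => ζ • u)) k hk (by
      rintro _ ⟨ζ, rfl⟩
      exact ⟨((wderiv_sum_eq_zero_iff _ _ _).1 (hzero ζ)).1, hyp _ (hzero ζ)⟩)
  have hcont : Continuous (fun y : ℂ => ‖(y - x) • u‖) := by fun_prop
  have ev : ∀ᶠ y in nhds x, ‖(y - x) • u‖ < r :=
    hcont.continuousAt.eventually_lt continuousAt_const (by simpa using hr)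
  filter_upwards [ev] with y hy hne
  have := hmin ((y - x) • u) ⟨y - x, rfl⟩ (smul_ne_zero (sub_ne_zero.2 hne) hu) hy
  rwa [show p + x • u + (y - x) • u = p + y • u by rw [sub_smul]; abel] at this

lemma tangent_unique (H : FiberOK g R) (p w : Fin n → ℂ) (hp : 0 < g p) (hpR : g p ≤ R)
    (hw : g w ≤ g p) (ht : ∑ j, (w j - p j) * wderiv g p j = 0) : w = p := by
  by_contra hne
  set u := w - p with hu
  have hu0 : u ≠ 0 := sub_ne_zero.2 hne
  set h : ℂ → ℝ := fun ζ => g (p + ζ • u) with hh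
  have hcont : Continuous h := H.cont.comp (by fun_prop)
  have hset : {ζ | h ζ ≤ R} = {ζ : ℂ | euclNorm (p + ζ • u) ≤ R} := by
    ext ζ
    exact H.le_iff _
  have hconv : Convex ℝ {ζ | h ζ ≤ R} := by
    rw [hset]
    intro x hx y hy a b ha hb hab
    have := euclNorm_convex (n := n) R hx hy ha hb hab
    change euclNorm _ ≤ R at this
    change euclNorm _ ≤ R
    convert this using 2
    have h1 : p = a • p + b • p := by rw [← add_smul, hab, one_smul]
    conv_lhs => rw [h1]
    simp only [add_smul, smul_add, smul_assoc]
    abel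
  have hcomp : IsCompact {ζ | h ζ ≤ R} := by
    refine Metric.isCompact_of_isClosed_isBounded (isClosed_le hcont continuous_const) ?_
    refine (Metric.isBounded_iff_subset_closedBall 0).2 ⟨(R + ‖p‖) / ‖u‖, ?_⟩
    intro ζ hζ
    have h1 : euclNorm (p + ζ • u) ≤ R := (H.le_iff _).1 hζ
    have h2 := (norm_le_euclNorm _).trans h1
    have h3 : ‖ζ • u‖ ≤ R + ‖p‖ := by
      calc ‖ζ • u‖ = ‖(p + ζ • u) - p‖ := by congr 1; abel
        _ ≤ ‖p + ζ • u‖ + ‖p‖ := norm_sub_le _ _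
        _ ≤ _ := by linarith
    rw [norm_smul] at h3
    rw [mem_closedBall_zero_iff, le_div_iff₀ (norm_pos_iff.2 hu0)]
    exact h3
  refine mountain_pass h hcont R hcomp hconv.isPreconnected ?_ 0 1 zero_ne_one ?_ ?_ ?_
  · intro x hx
    by_cases h0 : g (p + x • u) = 0
    · left
      refine Eventually.of_forall ?_
      intro y hy
      change g (p + x • u) < g (p + y • u)
      rw [h0]
      refine lt_of_le_of_ne (H.nonneg _) ?_
      intro h1
      have h2 := (H.zero _).1 h0
      have h3 := (H.zero _).1 h1.symm
      have h4 : (y - x) • u = 0 := by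
        rw [sub_smul, ← add_sub_add_left_eq_sub _ _ p, h2, h3, sub_zero]
      rcases smul_eq_zero.1 h4 with h5 | h5
      · exact hy (sub_eq_zero.1 h5)
      · exact hu0 h5
    · have hl : HasFDerivAt (fun ζ : ℂ => p + ζ • u)
          ((ContinuousLinearMap.id ℝ ℂ).smulRight u) x := by
        exact ((ContinuousLinearMap.id ℝ ℂ).smulRight u).hasFDerivAt.const_add p
      have hd := ((H.smooth _ h0).differentiableAt (by simp)).hasFDerivAt.comp x hl
      by_cases hz : fderiv ℝ h x = 0
      · left
        refine H.isoPt p u hu0 x h0 ?_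
        rw [wderiv_sum_eq_zero_iff]
        have hfd : fderiv ℝ h x = _ := hd.fderiv
        rw [hz] at hfd
        have h1 := congrArg (fun T : ℂ →L[ℝ] ℝ => T 1) hfd
        have h2 := congrArg (fun T : ℂ →L[ℝ] ℝ => T Complex.I) hfd
        simp at h1 h2
        exact ⟨h1.symm, h2.symm⟩
      · right
        refine regPt_of_fderiv h x ?_ hz
        have h1 : ContDiffAt ℝ 1 g (p + x • u) := (H.smooth _ h0).of_le (by norm_num)
        exact h1.comp x (by fun_prop)
  · simpa [hh, hu] using hw
  · simpa [hh] using hpR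
  · refine H.isoPt p u hu0 0 (by simpa using hp.ne') ?_
    simpa [hu] using ht

lemma sum_ne_zero (H : FiberOK g R) (p : Fin n → ℂ) (hp : 0 < g p) (hpR : g p ≤ R) :
    ∑ k, p k * wderiv g p k ≠ 0 := by
  intro h
  have h0 : g 0 = 0 := (H.zero 0).2 rfl
  have h1 := H.tangent_unique p 0 hp hpR (by rw [h0]; exact hp.le) (by simpa using h)
  rw [← h1, h0] at hp
  exact lt_irrefl _ hp

/-- The normalized gradient. -/
def _root_.nGrad {n : ℕ} (g : (Fin n → ℂ) → ℝ) (p : Fin n → ℂ) (j : Fin n) : ℂ :=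
  wderiv g p j / ∑ k, p k * wderiv g p k

lemma nGrad_eq_one (H : FiberOK g R) (p : Fin n → ℂ) (hp : 0 < g p) (hpR : g p ≤ R) 
    (w : Fin n → ℂ) (hw : g w ≤ g p) (h1 : ∑ j, w j * nGrad g p j = 1) : w = p := by
  have h0 := H.sum_ne_zero p hp hpR
  refine H.tangent_unique p w hp hpR hw ?_
  simp only [nGrad, mul_div_assoc'] at h1
  rw [← Finset.sum_div, div_eq_one_iff_eq h0] at h1
  simp only [sub_mul, Finset.sum_sub_distrib, h1, sub_self]

lemma nGrad_self (H : FiberOK g R) (p : Fin n → ℂ) (hp : 0 < g p) (hpR : g p ≤ R) :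
    ∑ j, p j * nGrad g p j = 1 := by
  have h0 := H.sum_ne_zero p hp hpR
  simp only [nGrad, mul_div_assoc']
  rw [← Finset.sum_div, div_self h0]

lemma compact_le (H : FiberOK g R) : IsCompact {w | g w ≤ R} := by
  refine Metric.isCompact_of_isClosed_isBounded (isClosed_le H.cont continuous_const) ?_
  refine (Metric.isBounded_iff_subset_closedBall 0).2 ⟨R, ?_⟩
  intro w hw
  rw [mem_closedBall_zero_iff]
  exact (norm_le_euclNorm _).trans ((H.le_iff _).1 hw)

/-- Sublevel sets: every point is connected with `0`. -/
lemma inner_conn (H : FiberOK g R) (t : ℝ) (htR : t ≤ R) (w : Fin n → ℂ) (hw : g w < t) :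
    ∃ C : Set (Fin n → ℂ), IsPreconnected C ∧ w ∈ C ∧ 0 ∈ C ∧ ∀ y ∈ C, g y < t := by
  set U := {y | g y < t} with hU
  have hUo : IsOpen U := isOpen_lt H.cont continuous_const
  set C := connectedComponentIn U w with hC
  have hCo : IsOpen C := hUo.connectedComponentIn
  have hCp : IsPreconnected C := isPreconnected_connectedComponentIn
  have hCU : C ⊆ U := connectedComponentIn_subset U w
  have hwC : w ∈ C := mem_connectedComponentIn hw
  refine ⟨C, hCp, hwC, ?_, fun y hy => hCU hy⟩
  have hcl : closure C ⊆ {y | g y ≤ R} := closure_minimal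
    (fun y hy => by have h9 : g y < t := hCU hy; exact h9.le.trans htR)
    (isClosed_le H.cont continuous_const)
  obtain ⟨x, hx, hmin⟩ := (H.compact_le.of_isClosed_subset isClosed_closure hcl).exists_isMinOn
    ⟨w, subset_closure hwC⟩ H.cont.continuousOn
  have hxw : g x ≤ g w := hmin (subset_closure hwC)
  have hxC : x ∈ C := by
    have h1 : IsPreconnected (insert x C) :=
      hCp.subset_closure (subset_insert _ _) (insert_subset hx subset_closure)
    exact h1.subset_connectedComponentIn (mem_insert_of_mem _ hwC)
      (insert_subset (hxw.trans_lt hw) hCU) (mem_insert _ _)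
  have hloc : IsLocalMin g x := by
    filter_upwards [hCo.mem_nhds hxC] with y hy
    exact hmin (subset_closure hy)
  have hx0 : g x = 0 := by
    by_contra hne
    exact H.grad x (lt_of_le_of_ne (H.nonneg x) (Ne.symm hne)) (hcl hx) hloc.fderiv_eq_zero
  rw [(H.zero x).1 hx0] at hxC
  exact hxC

/-- Every point of the shell is connected with the outer sphere. -/
lemma outer_conn (H : FiberOK g R) (t : ℝ) (ht : 0 < t) (w : Fin n → ℂ) (hw : t < g w) (hwR : g w ≤ R) :
    ∃ C : Set (Fin n → ℂ), ∃ x, IsPreconnected C ∧ w ∈ C ∧ x ∈ C ∧ g x = R ∧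
      ∀ y ∈ C, t < g y ∧ g y ≤ R := by
  rcases hwR.eq_or_lt with hwR | hwR
  · exact ⟨{w}, w, isPreconnected_singleton, rfl, rfl, hwR, by rintro y rfl; exact ⟨hw, hwR.le⟩⟩
  set U := {y | t < g y ∧ g y < R} with hU
  have hUo : IsOpen U := (isOpen_lt continuous_const H.cont).inter (isOpen_lt H.cont continuous_const)
  set C := connectedComponentIn U w with hC
  have hCo : IsOpen C := hUo.connectedComponentIn
  have hCp : IsPreconnected C := isPreconnected_connectedComponentIn
  have hCU : C ⊆ U := connectedComponentIn_subset U w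
  have hwC : w ∈ C := mem_connectedComponentIn ⟨hw, hwR⟩
  have hcl : closure C ⊆ {y | g y ≤ R} := closure_minimal
    (fun y hy => by have h9 : g y < R := (hCU hy).2; exact h9.le)
    (isClosed_le H.cont continuous_const)
  obtain ⟨x, hx, hmax⟩ := (H.compact_le.of_isClosed_subset isClosed_closure hcl).exists_isMaxOn
    ⟨w, subset_closure hwC⟩ H.cont.continuousOn
  have hxw : g w ≤ g x := hmax (subset_closure hwC)
  have hxR : g x ≤ R := hcl hx
  have h1 : IsPreconnected (insert x C) :=
    hCp.subset_closure (subset_insert _ _) (insert_subset hx subset_closure)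
  refine ⟨insert x C, x, h1, mem_insert_of_mem _ hwC, mem_insert _ _, ?_, ?_⟩
  · by_contra hne
    have hlt : g x < R := lt_of_le_of_ne hxR hne
    have hxC : x ∈ C := h1.subset_connectedComponentIn (mem_insert_of_mem _ hwC)
      (insert_subset (show x ∈ U from ⟨hw.trans_le hxw, hlt⟩) hCU) (mem_insert _ _)
    have hloc : IsLocalMax g x := by
      filter_upwards [hCo.mem_nhds hxC] with y hy
      exact hmax (subset_closure hy)
    exact H.grad x (by linarith) hxR hloc.fderiv_eq_zero
  · rintro y (rfl | hy)
    · exact ⟨hw.trans_le hxw, hxR⟩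
    · have h9 := hCU hy
      exact ⟨h9.1, h9.2.le⟩

/-- A point of the level set together with a hyperplane avoiding the sublevel set. -/
lemma eq_nGrad (H : FiberOK g R) (p η : Fin n → ℂ) (hp : 0 < g p) (hpR : g p ≤ R)
    (h1 : ∑ j, p j * η j = 1) (h2 : ∀ w, g w < g p → ∑ j, w j * η j ≠ 1) :
    η = nGrad g p := by
  have hd := ((H.smooth p hp.ne').differentiableAt (by simp)).hasFDerivAt
  have hz : ∀ u : Fin n → ℂ, ∑ j, u j * η j = 0 → fderiv ℝ g p u = 0 := by
    intro u hu
    have hl : HasDerivAt (fun s : ℝ => p + s • u) u 0 := by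
      simpa using ((hasDerivAt_id (0:ℝ)).smul_const u).const_add p
    have hd' : HasFDerivAt g (fderiv ℝ g p) (p + (0:ℝ) • u) := by simpa using hd
    have hder := hd'.comp_hasDerivAt (0:ℝ) hl
    have hmin : IsLocalMin (g ∘ fun s : ℝ => p + s • u) 0 := by
      refine Eventually.of_forall ?_
      intro s
      simp only [Function.comp, zero_smul, add_zero]
      by_contra! hlt
      refine h2 _ hlt ?_
      simp only [Pi.add_apply, Pi.smul_apply, add_mul, Finset.sum_add_distrib, h1, smul_mul_assoc]
      rw [← Finset.smul_sum, hu, smul_zero, add_zero]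
    exact hmin.hasDerivAt_eq_zero hder
  have hz2 : ∀ u : Fin n → ℂ, ∑ j, u j * η j = 0 → ∑ j, u j * wderiv g p j = 0 := by
    intro u hu
    rw [wderiv_sum_eq_zero_iff]
    refine ⟨hz u hu, hz _ ?_⟩
    simp only [Pi.smul_apply, smul_mul_assoc]
    rw [← Finset.smul_sum, hu, smul_zero]
  have h0 := H.sum_ne_zero p hp hpR
  ext i
  have h3 := hz2 (Pi.single i 1 - η i • p) (by
    simp only [Pi.sub_apply, Pi.smul_apply, sub_mul, Finset.sum_sub_distrib, smul_mul_assoc]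
    rw [← Finset.smul_sum, h1]
    simp [Pi.single_apply])
  simp only [Pi.sub_apply, Pi.smul_apply, sub_mul, Finset.sum_sub_distrib, smul_mul_assoc] at h3
  rw [← Finset.smul_sum] at h3
  simp [Pi.single_apply] at h3
  rw [nGrad, eq_div_iff h0]
  exact (sub_eq_zero.1 h3).symm

end FiberOK

section Oka

variable {N : ℕ}

def InvOn' (X : Set (Fin N → ℂ)) (P : MvPolynomial (Fin N) ℂ) : Prop :=
  ∃ Q : MvPolynomial (Fin N) ℂ, ∃ r : ℝ, 0 ≤ r ∧ r < 1 ∧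
    ∀ x ∈ X, ‖1 - MvPolynomial.eval x P * MvPolynomial.eval x Q‖ ≤ r

/-- `p` is in the hull of `X` (with nonnegative bounds). -/
def HullPt (X : Set (Fin N → ℂ)) (p : Fin N → ℂ) : Prop :=
  ∀ P : MvPolynomial (Fin N) ℂ, ∀ M : ℝ, 0 ≤ M →
    (∀ x ∈ X, ‖MvPolynomial.eval x P‖ ≤ M) → ‖MvPolynomial.eval p P‖ ≤ M

lemma InvOn'.ne_zero {X : Set (Fin N → ℂ)} {P : MvPolynomial (Fin N) ℂ} (h : InvOn' X P)
    {p : Fin N → ℂ} (hp : HullPt X p) : MvPolynomial.eval p P ≠ 0 := by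
  obtain ⟨Q, r, hr0, hr, hQ⟩ := h
  intro h0
  have := hp (1 - P * Q) r hr0 (by intro x hx; simpa using hQ x hx)
  simp [h0] at this
  linarith

lemma InvOn'.step {X : Set (Fin N → ℂ)} {P P' : MvPolynomial (Fin N) ℂ} (h : InvOn' X P)
    (δ : ℝ) (hδ : 0 < δ) (hlow : ∀ x ∈ X, δ ≤ ‖MvPolynomial.eval x P‖)
    (hclose : ∀ x ∈ X, ‖MvPolynomial.eval x P' - MvPolynomial.eval x P‖ ≤ δ / 4) :
    InvOn' X P' := by
  obtain ⟨Q, r, hr0, hr, hQ⟩ := h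
  obtain ⟨m, hm⟩ := exists_pow_lt_of_lt_one (show (0:ℝ) < 1/2 by norm_num) hr
  set Q' := Q * ∑ k ∈ Finset.range m, (1 - P * Q) ^ k with hQ'
  have hQ'e : ∀ x ∈ X, ‖1 - MvPolynomial.eval x P * MvPolynomial.eval x Q'‖ ≤ 1/2 := by
    intro x hx
    have h1 : 1 - P * Q' = (1 - P * Q) ^ m := by
      have := mul_neg_geom_sum (1 - P * Q) m
      rw [sub_sub_cancel] at this
      rw [hQ', ← mul_assoc, this, sub_sub_cancel]
    have h2 := congrArg (MvPolynomial.eval x) h1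
    simp only [map_sub, map_one, map_mul, map_pow] at h2
    rw [h2, norm_pow]
    exact (pow_le_pow_left₀ (norm_nonneg _) (hQ x hx) m).trans hm.le
  refine ⟨Q', 7/8, by norm_num, by norm_num, ?_⟩
  intro x hx
  set a := MvPolynomial.eval x P
  set a' := MvPolynomial.eval x P'
  set q := MvPolynomial.eval x Q'
  have h1 := hQ'e x hx
  have h2 := hlow x hx
  have h3 := hclose x hx
  have h4 : ‖a * q‖ ≤ 3/2 := by
    calc ‖a * q‖ = ‖1 - (1 - a * q)‖ := by congr 1; ring
      _ ≤ ‖(1:ℂ)‖ + ‖1 - a * q‖ := norm_sub_le _ _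
      _ ≤ 3/2 := by rw [norm_one]; change ‖1 - a * q‖ ≤ 1/2 at h1; linarith
  rw [norm_mul] at h4
  have h5 : δ * ‖q‖ ≤ 3/2 := (mul_le_mul_of_nonneg_right h2 (norm_nonneg _)).trans h4
  calc ‖1 - a' * q‖ = ‖(1 - a * q) - (a' - a) * q‖ := by congr 1; ring
    _ ≤ ‖1 - a * q‖ + ‖(a' - a) * q‖ := norm_sub_le _ _
    _ ≤ 1/2 + δ / 4 * ‖q‖ := by
        rw [norm_mul]
        exact add_le_add h1 (mul_le_mul_of_nonneg_right h3 (norm_nonneg _))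
    _ ≤ 7/8 := by linarith

def linP {n : ℕ} (e : Fin n → Fin N) (a : Fin n → ℂ) : MvPolynomial (Fin N) ℂ :=
  1 - ∑ j, MvPolynomial.C (a j) * MvPolynomial.X (e j)

lemma eval_linP {n : ℕ} (e : Fin n → Fin N) (a : Fin n → ℂ) (x : Fin N → ℂ) :
    MvPolynomial.eval x (linP e a) = 1 - ∑ j, a j * x (e j) := by
  simp [linP]

lemma lin_hull {n : ℕ} (e : Fin n → Fin N) (X : Set (Fin N → ℂ)) (hX : IsCompact X)
    (C : Set (Fin n → ℂ)) (hC : IsPreconnected C) (h0 : (0 : Fin n → ℂ) ∈ C)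
    (hne : ∀ a ∈ C, ∀ x ∈ X, ∑ j, a j * x (e j) ≠ 1)
    (p : Fin N → ℂ) (hp : HullPt X p) (a : Fin n → ℂ) (ha : a ∈ C) :
    ∑ j, a j * p (e j) ≠ 1 := by
  obtain ⟨B, hB⟩ := hX.isBounded.exists_norm_le
  have hlow : ∀ a ∈ C, ∃ δ > 0, ∀ x ∈ X, δ ≤ ‖MvPolynomial.eval x (linP e a)‖ := by
    intro a ha
    rcases X.eq_empty_or_nonempty with he | hXne
    · exact ⟨1, one_pos, by simp [he]⟩
    · have hcont : ContinuousOn (fun x => ‖MvPolynomial.eval x (linP e a)‖) X := by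
        simp only [eval_linP]
        fun_prop
      obtain ⟨x0, hx0, hmin⟩ := hX.exists_isMinOn hXne hcont
      refine ⟨_, ?_, fun x hx => hmin hx⟩
      rw [gt_iff_lt, norm_pos_iff, eval_linP]
      exact fun h => hne a ha x0 hx0 (sub_eq_zero.1 h).symm
  have hdiff : ∀ a b : Fin n → ℂ, ∀ x ∈ X,
      ‖MvPolynomial.eval x (linP e b) - MvPolynomial.eval x (linP e a)‖ ≤ n * (‖b - a‖ * B) := by
    intro a b x hx
    rw [eval_linP, eval_linP, sub_sub_sub_cancel_left, ← Finset.sum_sub_distrib]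
    refine (norm_sum_le _ _).trans ?_
    have : ∀ j ∈ (Finset.univ : Finset (Fin n)), ‖a j * x (e j) - b j * x (e j)‖ ≤ ‖b - a‖ * B := by
      intro j _
      rw [← sub_mul, norm_mul, ← norm_neg, neg_sub]
      refine mul_le_mul (norm_le_pi_norm (b - a) j) ((norm_le_pi_norm x (e j)).trans (hB x hx))
        (norm_nonneg _) (norm_nonneg _)
    refine (Finset.sum_le_card_nsmul _ _ _ this).trans ?_
    simp
  have hinv : InvOn' X (linP e a) := by
    have h00 : InvOn' X (linP e (0 : Fin n → ℂ)) := ⟨1, 0, le_rfl, one_pos, by simp [eval_linP]⟩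
    refine hC.induction₂' (fun a b => InvOn' X (linP e a) → InvOn' X (linP e b)) ?_ ?_ h0 ha h00
    · intro a ha
      obtain ⟨δ, hδ, hl⟩ := hlow a ha
      have hcont : Continuous (fun b : Fin n → ℂ => n * (‖b - a‖ * B)) := by fun_prop
      have ev : ∀ᶠ b in nhds a, n * (‖b - a‖ * B) < δ / 8 :=
        hcont.continuousAt.eventually_lt continuousAt_const (by simpa using hδ)
      filter_upwards [ev.filter_mono nhdsWithin_le_nhds] with b hb
      constructor
      · intro h
        exact h.step δ hδ hl (fun x hx => (hdiff a b x hx).trans (by linarith))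
      · intro h
        refine h.step (δ/2) (by positivity) ?_ ?_
        · intro x hx
          have h1 := hdiff a b x hx
          have h2 := hl x hx
          rw [norm_sub_rev] at h1
          have h3 := norm_sub_norm_le (MvPolynomial.eval x (linP e a)) (MvPolynomial.eval x (linP e b))
          linarith
        · intro x hx
          rw [norm_sub_rev]
          exact (hdiff a b x hx).trans (by linarith)
    · intro x y z _ _ _ h1 h2 h3
      exact h2 (h1 h3)
  have := hinv.ne_zero hp
  rw [eval_linP] at this
  exact fun h => this (by rw [h, sub_self])

lemma norm_peak_lt (z z0 : ℂ) (hz : ‖z‖ = 1) (hz0 : ‖z0‖ = 1) (hne : z ≠ z0) :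
    ‖(1/2 : ℂ) * (1 + (starRingEnd ℂ) z0 * z)‖ < 1 := by
  have h1 : z.re ^ 2 + z.im ^ 2 = 1 := by
    have := Complex.sq_norm z
    rw [hz, Complex.normSq_apply] at this
    linarith
  have h2 : z0.re ^ 2 + z0.im ^ 2 = 1 := by
    have := Complex.sq_norm z0
    rw [hz0, Complex.normSq_apply] at this
    linarith
  have h3 : 0 < (z.re - z0.re) ^ 2 + (z.im - z0.im) ^ 2 := by
    by_contra! hle
    apply hne
    apply Complex.ext <;> nlinarith [sq_nonneg (z.re - z0.re), sq_nonneg (z.im - z0.im)]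
  rw [← sq_lt_one_iff₀ (norm_nonneg _), Complex.sq_norm, Complex.normSq_mul, Complex.normSq_apply (1 + _)]
  have h4 : Complex.normSq (1/2 : ℂ) = 1/4 := by norm_num [Complex.normSq_apply]
  rw [h4]
  simp only [Complex.add_re, Complex.add_im, Complex.one_re, Complex.one_im, Complex.mul_re,
    Complex.mul_im, Complex.conj_re, Complex.conj_im]
  have h5 : (z0.re * z.re + z0.im * z.im) ^ 2 + (z0.re * z.im - z0.im * z.re) ^ 2 = 1 := by
    calc _ = (z0.re ^ 2 + z0.im ^ 2) * (z.re ^ 2 + z.im ^ 2) := by ring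
      _ = 1 := by rw [h1, h2]; ring
  nlinarith

/-- Hulls over peak points. -/
lemma peak_hull (X : Set (Fin (N+1) → ℂ)) (hX : IsCompact X) (hXc : ∀ x ∈ X, ‖x 0‖ = 1)
    (p : Fin (N+1) → ℂ) (hp0 : ‖p 0‖ = 1) (hp : HullPt X p) :
    HullPt (X ∩ {x | x 0 = p 0}) p := by
  intro P M hM hPM
  refine le_of_forall_pos_le_add ?_
  intro ε hε
  set T : MvPolynomial (Fin (N+1)) ℂ := MvPolynomial.C (1/2) *
    (1 + MvPolynomial.C ((starRingEnd ℂ) (p 0)) * MvPolynomial.X 0) with hT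
  have hTe : ∀ x, MvPolynomial.eval x T = (1/2 : ℂ) * (1 + (starRingEnd ℂ) (p 0) * x 0) := by
    intro x; simp [hT]
  have hTp : MvPolynomial.eval p T = 1 := by
    rw [hTe, mul_comm ((starRingEnd ℂ) (p 0)), Complex.mul_conj, Complex.normSq_eq_norm_sq, hp0]
    norm_num
  have hTlt : ∀ x ∈ X, x 0 ≠ p 0 → ‖MvPolynomial.eval x T‖ < 1 := by
    intro x hx hne
    rw [hTe]
    exact norm_peak_lt _ _ (hXc x hx) hp0 hne
  have hTle : ∀ x ∈ X, ‖MvPolynomial.eval x T‖ ≤ 1 := by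
    intro x hx
    by_cases h : x 0 = p 0
    · have : MvPolynomial.eval x T = MvPolynomial.eval p T := by rw [hTe, hTe, h]
      rw [this, hTp, norm_one]
    · exact (hTlt x hx h).le
  have hcP : Continuous (fun x => ‖MvPolynomial.eval x P‖) := (MvPolynomial.continuous_eval P).norm
  have hcT : Continuous (fun x => ‖MvPolynomial.eval x T‖) := (MvPolynomial.continuous_eval T).norm
  set F := X ∩ {x | M + ε ≤ ‖MvPolynomial.eval x P‖} with hF
  have hFc : IsCompact F := hX.inter_right (isClosed_le continuous_const hcP)
  have hFne : ∀ x ∈ F, ‖MvPolynomial.eval x T‖ < 1 := by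
    rintro x ⟨hx, hx2⟩
    apply hTlt x hx
    intro h
    have := hPM x ⟨hx, h⟩
    change M + ε ≤ _ at hx2
    linarith
  obtain ⟨m, hm⟩ : ∃ m : ℕ, ∀ x ∈ F, ‖MvPolynomial.eval x (P * T ^ m)‖ ≤ M + ε := by
    rcases F.eq_empty_or_nonempty with he | hne
    · exact ⟨0, by simp [he]⟩
    · obtain ⟨x1, hx1, hmax1⟩ := hFc.exists_isMaxOn hne hcP.continuousOn
      obtain ⟨x2, hx2, hmax2⟩ := hFc.exists_isMaxOn hne hcT.continuousOn
      obtain ⟨m, hm⟩ := exists_pow_lt_of_lt_one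
        (show 0 < (M + ε) / (‖MvPolynomial.eval x1 P‖ + 1) by positivity) (hFne x2 hx2)
      refine ⟨m, fun x hx => ?_⟩
      rw [map_mul, map_pow, norm_mul, norm_pow]
      have h1 : ‖MvPolynomial.eval x P‖ ≤ ‖MvPolynomial.eval x1 P‖ + 1 :=
        (show ‖MvPolynomial.eval x P‖ ≤ ‖MvPolynomial.eval x1 P‖ from hmax1 hx).trans (by linarith)
      have h2 : ‖MvPolynomial.eval x T‖ ^ m ≤ (M + ε) / (‖MvPolynomial.eval x1 P‖ + 1) :=
        (pow_le_pow_left₀ (norm_nonneg _) (hmax2 hx) m).trans hm.le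
      calc _ ≤ (‖MvPolynomial.eval x1 P‖ + 1) * ((M + ε) / (‖MvPolynomial.eval x1 P‖ + 1)) :=
            mul_le_mul h1 h2 (by positivity) (by positivity)
        _ = M + ε := by field_simp
  have := hp (P * T ^ m) (M + ε) (by positivity) (by
    intro x hx
    by_cases hxF : x ∈ F
    · exact hm x hxF
    · have h1 : ‖MvPolynomial.eval x P‖ < M + ε := by
        by_contra! hle
        exact hxF ⟨hx, hle⟩
      rw [map_mul, map_pow, norm_mul, norm_pow]
      have h2 := pow_le_one₀ (n := m) (norm_nonneg _) (hTle x hx)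
      calc _ ≤ ‖MvPolynomial.eval x P‖ * 1 := mul_le_mul_of_nonneg_left h2 (norm_nonneg _)
        _ ≤ _ := by linarith)
  rw [map_mul, map_pow, hTp, one_pow, mul_one] at this
  exact this

end Oka

section Final

variable {n : ℕ} {ρ : ℂ → (Fin n → ℂ) → ℝ} {R : ℝ}

lemma fiberOK_of_cond3 (hρ : Cond3 n ρ R (fun _ => 0)) (z : ℂ) (hz : z ∈ Circ) :
    FiberOK (ρ z) R := by
  have hcont : Continuous (ρ z) := by
    have h1 : ContinuousOn (fun w : Fin n → ℂ => ((z, w) : ℂ × (Fin n → ℂ))) univ := by fun_prop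
    have := hρ.cont.comp h1 (fun w _ => hz)
    exact continuousOn_univ.1 this
  have hopen : IsOpen {w | ρ z w ≠ 0} := isOpen_ne_fun hcont continuous_const
  refine ⟨hcont, ?_, hρ.nonneg z hz, by linarith [hρ.hR], hρ.grad_ne z hz, ?_, hρ.levelR z hz,
    hρ.aboveR z hz, hρ.Szero z hz⟩
  · intro w hw
    have h1 : ContDiffOn ℝ 6 (fun w : Fin n → ℂ => ((z, w) : ℂ × (Fin n → ℂ))) {w | ρ z w ≠ 0} :=
      (contDiff_const.prodMk contDiff_id).contDiffOn
    have h2 : ContDiffOn ℝ 6 (ρ z) {w | ρ z w ≠ 0} := hρ.smooth.comp h1 (fun w hw => ⟨hz, hw⟩)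
    exact (h2.contDiffAt (hopen.mem_nhds hw)).of_le (by norm_num)
  · intro w hw
    obtain ⟨k, hk, h⟩ := hρ.hypo {(z, w)} (by rintro _ rfl; exact ⟨hz, hw⟩) isCompact_singleton
    refine ⟨k, hk, fun u hu => ?_⟩
    have h1 := h (z, w) rfl u hu
    rw [iteratedFDeriv_two_apply] at h1
    simp only [Matrix.cons_val_zero, Matrix.cons_val_one] at h1
    refine le_trans ?_ h1
    have := norm_le_euclNorm u
    gcongr

lemma fderiv_continuousOn (hρ : Cond3 n ρ R (fun _ => 0)) :
    ContinuousOn (fun p : ℂ × (Fin n → ℂ) => fderiv ℝ (ρ p.1) p.2)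
      {p | p.1 ∈ Circ ∧ ρ p.1 p.2 ≠ 0} := by
  set X : Set (ℂ × (Fin n → ℂ)) := {p | p.1 ∈ Circ ∧ ρ p.1 p.2 ≠ 0} with hX
  intro p0 hp0
  have h1 : ContDiffWithinAt ℝ (0 + 1) (fun p : ℂ × (Fin n → ℂ) => ρ p.1 p.2) X p0 :=
    (hρ.smooth p0 hp0).of_le (by norm_num)
  obtain ⟨u, hu, -, F', hF', hF'c⟩ := (contDiffWithinAt_succ_iff_hasFDerivWithinAt (by simp)).1 h1
  rw [insert_eq_of_mem hp0] at hu
  obtain ⟨O, hO, hp0O, hOu⟩ := mem_nhdsWithin.1 hu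
  have heq : ∀ p ∈ O ∩ X, fderiv ℝ (ρ p.1) p.2 =
      (F' p).comp (ContinuousLinearMap.inr ℝ ℂ (Fin n → ℂ)) := by
    rintro ⟨z, w⟩ hp
    have hz : z ∈ Circ := hp.2.1
    have hcont := (fiberOK_of_cond3 hρ z hz).cont
    have h2 := hF' (z, w) (hOu hp)
    have h3 : HasFDerivAt (fun w' : Fin n → ℂ => ((z, w') : ℂ × (Fin n → ℂ)))
        (ContinuousLinearMap.inr ℝ ℂ (Fin n → ℂ)) w := hasFDerivAt_prodMk_right z w
    have hpre : {w' : Fin n → ℂ | (z, w') ∈ O ∩ X} ∈ nhds w := by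
      have hc : Continuous (fun w' : Fin n → ℂ => ((z, w') : ℂ × (Fin n → ℂ))) := by fun_prop
      have e1 : ∀ᶠ w' in nhds w, (z, w') ∈ O := (hO.preimage hc).mem_nhds hp.1
      have e2 : ∀ᶠ w' in nhds w, ρ z w' ≠ 0 :=
        (isOpen_ne_fun hcont continuous_const).mem_nhds hp.2.2
      filter_upwards [e1, e2] with w' h1 h2
      exact ⟨h1, hz, h2⟩
    have h4 := h2.comp (s := {w' : Fin n → ℂ | (z, w') ∈ O ∩ X}) w h3.hasFDerivWithinAt
      (fun w' hw' => hOu hw')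
    exact (h4.hasFDerivAt hpre).fderiv
  have hc : ContinuousWithinAt (fun p => (F' p).comp (ContinuousLinearMap.inr ℝ ℂ (Fin n → ℂ))) X p0 :=
    (hF'c.continuousWithinAt.mono_of_mem_nhdsWithin hu).clm_comp continuousWithinAt_const
  refine hc.congr_of_eventuallyEq ?_ (heq p0 ⟨hp0O, hp0⟩)
  filter_upwards [mem_nhdsWithin_of_mem_nhds (hO.mem_nhds hp0O), self_mem_nhdsWithin] with p h1 h2
  exact heq p ⟨h1, h2⟩

lemma nGrad_continuousOn (hρ : Cond3 n ρ R (fun _ => 0)) :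
    ContinuousOn (fun p : ℂ × (Fin n → ℂ) => nGrad (ρ p.1) p.2)
      {p | p.1 ∈ Circ ∧ 0 < ρ p.1 p.2 ∧ ρ p.1 p.2 ≤ R} := by
  have h1 := (fderiv_continuousOn hρ).mono
    (show {p : ℂ × (Fin n → ℂ) | p.1 ∈ Circ ∧ 0 < ρ p.1 p.2 ∧ ρ p.1 p.2 ≤ R} ⊆ _ from
      fun p hp => ⟨hp.1, hp.2.1.ne'⟩)
  have hw : ∀ j, ContinuousOn (fun p : ℂ × (Fin n → ℂ) => wderiv (ρ p.1) p.2 j)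
      {p | p.1 ∈ Circ ∧ 0 < ρ p.1 p.2 ∧ ρ p.1 p.2 ≤ R} := by
    intro j
    have a1 := h1.clm_apply (continuousOn_const (c := (Pi.single j 1 : Fin n → ℂ)))
    have a2 := h1.clm_apply (continuousOn_const (c := (Pi.single j Complex.I : Fin n → ℂ)))
    have b1 := Complex.continuous_ofReal.comp_continuousOn a1
    have b2 := Complex.continuous_ofReal.comp_continuousOn a2
    exact (b1.sub (continuousOn_const.mul b2)).div_const 2
  rw [continuousOn_pi]
  intro j
  refine (hw j).div ?_ ?_
  · refine continuousOn_finsetSum _ (fun k _ => ContinuousOn.mul ?_ (hw k))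
    fun_prop
  · intro p hp
    exact (fiberOK_of_cond3 hρ p.1 hp.1).sum_ne_zero p.2 hp.2.1 hp.2.2

lemma nGrad_fiber_continuousOn (hρ : Cond3 n ρ R (fun _ => 0)) (z : ℂ) (hz : z ∈ Circ) :
    ContinuousOn (nGrad (ρ z)) {w | 0 < ρ z w ∧ ρ z w ≤ R} := by
  have h1 : ContinuousOn (fun w : Fin n → ℂ => ((z, w) : ℂ × (Fin n → ℂ)))
      {w | 0 < ρ z w ∧ ρ z w ≤ R} := by fun_prop
  have h2 := ContinuousOn.comp (g := fun p : ℂ × (Fin n → ℂ) => nGrad (ρ p.1) p.2)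
    (t := {p | p.1 ∈ Circ ∧ 0 < ρ p.1 p.2 ∧ ρ p.1 p.2 ≤ R})
    (nGrad_continuousOn hρ) h1 (fun w hw => ⟨hz, hw⟩)
  exact h2

lemma euclNorm_cs (a b : Fin n → ℂ) :
    ‖∑ j, (starRingEnd ℂ) (a j) * b j‖ ≤ euclNorm a * euclNorm b := by
  rw [euclNorm_eq, euclNorm_eq]
  have := norm_inner_le_norm (𝕜 := ℂ) (WithLp.toLp 2 a : EuclideanSpace ℂ (Fin n)) (WithLp.toLp 2 b)
  rw [PiLp.inner_apply] at this
  simpa [mul_comm] using this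

lemma euclNorm_sq (a : Fin n → ℂ) :
    ∑ j, (starRingEnd ℂ) (a j) * a j = ((euclNorm a ^ 2 : ℝ) : ℂ) := by
  rw [euclNorm, Real.sq_sqrt (Finset.sum_nonneg (fun j _ => Complex.normSq_nonneg _))]
  push_cast
  apply Finset.sum_congr rfl
  intro j _
  rw [mul_comm, Complex.mul_conj]

set_option maxHeartbeats 1000000 in
lemma outer_exists {g : (Fin n → ℂ) → ℝ} (H : FiberOK g R)
    (hcont : ContinuousOn (nGrad g) {w | 0 < g w ∧ g w ≤ R}) {t : ℝ} (ht : 0 < t) (htR : t ≤ R)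
    (w0 : Fin n → ℂ) (hlt : t < g w0) :
    ∃ C : Set (Fin n → ℂ), ∃ a ∈ C, IsPreconnected C ∧ 0 ∈ C ∧
        ∑ j, a j * w0 j = 1 ∧ ∀ a ∈ C, ∀ w, g w = t → ∑ j, a j * w j ≠ 1 := by
  rcases le_or_gt (g w0) R with hR | hR
  · obtain ⟨C, x, hC, hwC, hxC, hxR, hCt⟩ := H.outer_conn t ht w0 hlt hR
    have hsum : ∀ a b : Fin n → ℂ, ∑ j, a j * b j = ∑ j, b j * a j := fun a b =>
      Finset.sum_congr rfl (fun j _ => mul_comm _ _)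
    have hcg : ContinuousOn (nGrad g) C :=
      hcont.mono (fun y hy => ⟨ht.trans (hCt y hy).1, (hCt y hy).2⟩)
    refine ⟨nGrad g '' C ∪ (fun s : ℝ => s • nGrad g x) '' Icc 0 1, nGrad g w0,
      Or.inl ⟨w0, hwC, rfl⟩, ?_, Or.inr ⟨0, by simp, by simp⟩, ?_, ?_⟩
    · refine IsPreconnected.union (nGrad g x) ⟨x, hxC, rfl⟩ ⟨1, by simp, by simp⟩
        (hC.image _ hcg) (isPreconnected_Icc.image _ ?_)
      fun_prop
    · rw [hsum]
      exact H.nGrad_self w0 (ht.trans hlt) hR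
    · rintro _ (⟨q, hq, rfl⟩ | ⟨s, hs, rfl⟩) w hw heq
      · rw [hsum] at heq
        obtain ⟨h1, h2⟩ := hCt q hq
        have h3 := H.nGrad_eq_one q (ht.trans h1) h2 w (by rw [hw]; exact h1.le) heq
        rw [← h3, hw] at h1
        exact lt_irrefl _ h1
      · have htR' : t < R := by rw [← hxR]; exact (hCt x hxC).1
        have hwR : euclNorm w < R := (H.lt_iff w).1 (by rw [hw]; exact htR')
        have hnn : 0 ≤ euclNorm w := Real.sqrt_nonneg _
        have hsw : euclNorm (s • w) < R := by
          rw [euclNorm_smul s hs.1]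
          nlinarith [hs.1, hs.2]
        have h1 : ∑ j, (s • w) j * nGrad g x j = 1 := by
          rw [← heq]
          apply Finset.sum_congr rfl
          intro j _
          simp only [Pi.smul_apply, Complex.real_smul]
          ring
        have h2 : g (s • w) < R := (H.lt_iff _).2 hsw
        have h3 := H.nGrad_eq_one x (by rw [hxR]; exact H.hR) hxR.le (s • w)
          (by rw [hxR]; exact h2.le) h1
        rw [h3, hxR] at h2
        exact lt_irrefl _ h2
  · have hE : R < euclNorm w0 := by
      by_contra! hle
      have := (H.le_iff w0).2 hle
      linarith
    set E := euclNorm w0 with hEdef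
    have hE0 : 0 < E := H.hR.trans hE
    set a : Fin n → ℂ := fun j => (starRingEnd ℂ) (w0 j) / ((E ^ 2 : ℝ) : ℂ) with ha
    have hE2 : ((E ^ 2 : ℝ) : ℂ) ≠ 0 := by
      rw [Complex.ofReal_ne_zero]; positivity
    have hav : ∀ b : Fin n → ℂ, ∑ j, a j * b j =
        (∑ j, (starRingEnd ℂ) (w0 j) * b j) / ((E ^ 2 : ℝ) : ℂ) := by
      intro b
      rw [Finset.sum_div]
      apply Finset.sum_congr rfl
      intro j _
      simp only [ha]
      ring
    refine ⟨(fun s : ℝ => s • a) '' Icc 0 1, a, ⟨1, by simp, by simp⟩, ?_, ⟨0, by simp, by simp⟩, ?_, ?_⟩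
    · refine isPreconnected_Icc.image _ ?_
      fun_prop
    · rw [hav, euclNorm_sq, ← hEdef, div_self hE2]
    · rintro _ ⟨s, hs, rfl⟩ w hw heq
      have h1 : ∑ j, (s • a) j * w j = (s : ℂ) * ∑ j, a j * w j := by
        rw [Finset.mul_sum]
        apply Finset.sum_congr rfl
        intro j _
        simp only [Pi.smul_apply, Complex.real_smul]
        ring
      have h2 : ‖∑ j, a j * w j‖ < 1 := by
        rw [hav, norm_div, Complex.norm_real, Real.norm_of_nonneg (by positivity),
          div_lt_one (by positivity)]
        have h3 := euclNorm_cs w0 w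
        have h4 : euclNorm w ≤ R := (H.le_iff w).1 (by rw [hw]; exact htR)
        refine h3.trans_lt ?_
        rw [← hEdef]
        nlinarith
      have h5 := congrArg norm heq
      simp only [] at h5
      rw [h1, norm_mul, norm_one, Complex.norm_real, Real.norm_of_nonneg hs.1] at h5
      nlinarith [hs.1, hs.2, norm_nonneg (∑ j, a j * w j)]

end Final

def eW (n : ℕ) (j : Fin n) : Fin (n + n + 1) := Fin.succ (Fin.castAdd n j)
def eH (n : ℕ) (j : Fin n) : Fin (n + n + 1) := Fin.succ (Fin.natAdd n j)

lemma pc_zero {n : ℕ} (p : ℂ × ((Fin n → ℂ) × (Fin n → ℂ))) : pcoords2 p 0 = p.1 := by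
  simp [pcoords2]
lemma pc_W {n : ℕ} (p : ℂ × ((Fin n → ℂ) × (Fin n → ℂ))) (j : Fin n) :
    pcoords2 p (eW n j) = p.2.1 j := by
  simp [pcoords2, eW]
lemma pc_H {n : ℕ} (p : ℂ × ((Fin n → ℂ) × (Fin n → ℂ))) (j : Fin n) :
    pcoords2 p (eH n j) = p.2.2 j := by
  change Fin.append p.2.1 p.2.2 (Fin.natAdd n j) = _
  exact Fin.append_right _ _ _

lemma pc_continuous {n : ℕ} :
    Continuous (pcoords2 : ℂ × ((Fin n → ℂ) × (Fin n → ℂ)) → Fin (n + n + 1) → ℂ) := by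
  refine continuous_pi ?_
  intro i
  refine Fin.cases ?_ (fun i => ?_) i
  · simp only [pc_zero]; fun_prop
  · refine Fin.addCases (fun j => ?_) (fun j => ?_) i
    · change Continuous fun p => pcoords2 p (eW n j)
      simp only [pc_W]; fun_prop
    · change Continuous fun p => pcoords2 p (eH n j)
      simp only [pc_H]; fun_prop

/-- Lemma 2 (the fibers of the polynomial hull of `L^t` over `Γ` are the
fibers of `L^t`). -/
theorem statement9 {n : ℕ} (ρ : ℂ → (Fin n → ℂ) → ℝ) (R : ℝ)
    (hρ : Cond3 n ρ R (fun _ => 0))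
    (t : ℝ) (ht : 0 < t) (htR : t ≤ R)
    (Kt : Set (ℂ × (Fin n → ℂ)))
    (hKt : Kt = {p : ℂ × (Fin n → ℂ) | p.1 ∈ Circ ∧ ρ p.1 p.2 = t})
    (Ifun : ℂ × (Fin n → ℂ) → Fin n → ℂ)
    (hI : ∀ p : ℂ × (Fin n → ℂ), Ifun p =
      fun j => wderiv (ρ p.1) p.2 j / (∑ k, p.2 k * wderiv (ρ p.1) p.2 k))
    (Lt : Set (ℂ × ((Fin n → ℂ) × (Fin n → ℂ))))
    (hLt : Lt = (fun p : ℂ × (Fin n → ℂ) => (p.1, (p.2, Ifun p))) '' Kt) :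
    ∀ z ∈ Circ, {v : (Fin n → ℂ) × (Fin n → ℂ) | (z, v) ∈ polyHull2 Lt}
      = {v : (Fin n → ℂ) × (Fin n → ℂ) | (z, v) ∈ Lt} := by
  classical
  intro z hz
  have hIg : ∀ p, Ifun p = nGrad (ρ p.1) p.2 := fun p => hI p
  have hKt' : ∀ p ∈ Kt, p.1 ∈ Circ ∧ 0 < ρ p.1 p.2 ∧ ρ p.1 p.2 ≤ R := by
    intro p hp
    rw [hKt] at hp
    exact ⟨hp.1, by rw [hp.2]; exact ht, by rw [hp.2]; exact htR⟩
  have hKc : IsCompact Kt := by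
    rw [hKt]; exact hρ.levelCompact t ht htR
  have hIc : ContinuousOn Ifun Kt := by
    have : Ifun = fun p : ℂ × (Fin n → ℂ) => nGrad (ρ p.1) p.2 := funext hIg
    rw [this]
    exact (nGrad_continuousOn hρ).mono hKt'
  have hLc : IsCompact Lt := by
    rw [hLt]
    refine hKc.image_of_continuousOn ?_
    exact continuousOn_fst.prodMk (continuousOn_snd.prodMk hIc)
  set X : Set (Fin (n + n + 1) → ℂ) := pcoords2 '' Lt with hX
  have hXc : IsCompact X := hLc.image pc_continuous
  have H := fiberOK_of_cond3 hρ z hz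
  set g := ρ z with hg
  have hzn : ‖z‖ = 1 := by simpa [Circ] using hz
  ext ⟨w0, η0⟩
  constructor
  swap
  · intro hv P M hM
    exact hM _ hv
  intro hv
  have hp : HullPt X (pcoords2 (z, (w0, η0))) := by
    intro P M _ hPM
    exact hv P M (fun q hq => hPM _ ⟨q, hq, rfl⟩)
  have hX1 : ∀ x ∈ X, ‖x 0‖ = 1 := by
    rintro _ ⟨q, hq, rfl⟩
    rw [pc_zero]
    rw [hLt] at hq
    obtain ⟨p, hp, rfl⟩ := hq
    simpa [Circ] using (hKt' p hp).1
  have hp2 := peak_hull X hXc hX1 _ (by rw [pc_zero]; exact hzn) hp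
  rw [pc_zero] at hp2
  set Y := X ∩ {x | x 0 = z} with hY
  have hYc : IsCompact Y := hXc.inter_right (isClosed_eq (continuous_apply 0) continuous_const)
  have hYm : ∀ x ∈ Y, ∃ w, g w = t ∧ (∀ j, x (eW n j) = w j) ∧ ∀ j, x (eH n j) = nGrad g w j := by
    rintro _ ⟨⟨q, hq, rfl⟩, hq2⟩
    change pcoords2 q 0 = z at hq2
    rw [pc_zero] at hq2
    rw [hLt] at hq
    obtain ⟨p, hp, rfl⟩ := hq
    rw [hKt] at hp
    change p.1 = z at hq2
    refine ⟨p.2, ?_, fun j => pc_W _ j, fun j => ?_⟩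
    · rw [hg, ← hq2]; exact hp.2
    · rw [pc_H]
      change Ifun p j = nGrad g p.2 j
      rw [hIg, hq2]
  -- the pairing equals one
  have hpair : ∑ j, w0 j * η0 j = 1 := by
    have h1 := hp2 (1 - ∑ j, MvPolynomial.X (eW n j) * MvPolynomial.X (eH n j)) 0 le_rfl (by
      intro x hx
      obtain ⟨w, hw, hx1, hx2⟩ := hYm x hx
      have h2 := H.nGrad_self w (by rw [hw]; exact ht) (by rw [hw]; exact htR)
      simp [hx1, hx2, h2])
    simp only [map_sub, map_one, map_sum, map_mul, MvPolynomial.eval_X, pc_W, pc_H] at h1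
    exact (sub_eq_zero.1 (norm_le_zero_iff.1 h1)).symm
  -- inner hyperplanes
  have hinner : ∀ w', g w' < t → ∑ j, w' j * η0 j ≠ 1 := by
    intro w' hw'
    obtain ⟨C, hC, hwC, h0C, hCt⟩ := H.inner_conn t htR w' hw'
    have h1 := lin_hull (eH n) Y hYc C hC h0C (by
      intro a ha x hx heq
      obtain ⟨w, hw, hx1, hx2⟩ := hYm x hx
      simp only [hx2] at heq
      have hlt := hCt a ha
      have h2 := H.nGrad_eq_one w (by rw [hw]; exact ht) (by rw [hw]; exact htR) a
        (by rw [hw]; exact hlt.le) heq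
      rw [h2, hw] at hlt
      exact lt_irrefl _ hlt) _ hp2 w' hwC
    simpa only [pc_H] using h1
  -- outer hyperplanes
  have houter : g w0 ≤ t := by
    by_contra! hlt
    suffices hs : ∃ C : Set (Fin n → ℂ), ∃ a ∈ C, IsPreconnected C ∧ 0 ∈ C ∧
        ∑ j, a j * w0 j = 1 ∧ ∀ a ∈ C, ∀ w, g w = t → ∑ j, a j * w j ≠ 1 by
      obtain ⟨C, a, haC, hC, h0C, ha1, hCn⟩ := hs
      have h1 := lin_hull (eW n) Y hYc C hC h0C (by
        intro a ha x hx
        obtain ⟨w, hw, hx1, hx2⟩ := hYm x hx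
        simp only [hx1]
        exact hCn a ha w hw) _ hp2 a haC
      simp only [pc_W] at h1
      exact h1 ha1
    exact outer_exists H (nGrad_fiber_continuousOn hρ z hz) ht htR w0 hlt
  have hgw : g w0 = t := by
    refine le_antisymm houter ?_
    by_contra! hlt
    exact hinner w0 hlt hpair
  have hη := H.eq_nGrad w0 η0 (by rw [hgw]; exact ht) (by rw [hgw]; exact htR) hpair
    (by rw [hgw]; exact hinner)
  change (z, (w0, η0)) ∈ Lt
  rw [hLt]
  refine ⟨(z, w0), ?_, ?_⟩
  · rw [hKt]; exact ⟨hz, hgw⟩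
  · change (z, (w0, Ifun (z, w0))) = (z, (w0, η0))
    rw [hIg, hη]
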